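/- For all positive definite n×n complex matrices ρ, σ, define F(γ) := (1/(1−γ))·Tr[ρ·(log ρ − log(σ #_γ ρ))] for γ ∈ (0,1). Then: (a) F is monotone nondecreasing on (0,1); (b) lim_{γ→0⁺} F(γ) = Tr[ρ·(log ρ − log σ)] (the Umegaki relative entropy of ρ and σ); (c) lim_{γ→1⁻} F(γ) = Tr[ρ·log(ρ^{1/2}·σ^{-1}·ρ^{1/2})] (the Belavkin–Staszewski relative entropy of ρ and σ). Thus the γ-weighted geometric Umegaki relative entropies interpolate monotonically between the Umegaki and the Belavkin–Staszewski relative entropies on positive definite pairs. -/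

import Mathlib

open Matrix
open scoped ComplexOrder

/-- Functional calculus for Hermitian matrices: apply `f : ℝ → ℝ` to the eigenvalues
in a spectral decomposition (and return `0` on non-Hermitian input). -/
noncomputable def mfun {ι : Type*} [Fintype ι] [DecidableEq ι]
    (f : ℝ → ℝ) (A : Matrix ι ι ℂ) : Matrix ι ι ℂ :=
  letI := Classical.propDecidable A.IsHermitian
  if hA : A.IsHermitian then hA.cfc f else 0

/-- Real matrix power `A ^ γ` via functional calculus (with `Real.rpow` on eigenvalues,
so that `0 ^ γ = 0` for `γ ≠ 0`, giving the generalized inverse for `γ = -1`). -/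
noncomputable def mpow {ι : Type*} [Fintype ι] [DecidableEq ι]
    (A : Matrix ι ι ℂ) (γ : ℝ) : Matrix ι ι ℂ :=
  mfun (fun x => x ^ γ) A

/-- The `γ`-weighted geometric mean
`σ #_γ ρ := σ^{1/2} · (σ^{-1/2} · ρ · σ^{-1/2})^γ · σ^{1/2}`. -/
noncomputable def geomMean {ι : Type*} [Fintype ι] [DecidableEq ι]
    (σ ρ : Matrix ι ι ℂ) (γ : ℝ) : Matrix ι ι ℂ :=
  mpow σ (1 / 2) * mpow (mpow σ (-(1 / 2)) * ρ * mpow σ (-(1 / 2))) γ * mpow σ (1 / 2)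

/-- The `γ`-weighted geometric Umegaki relative entropy
`F(γ) := (1/(1-γ)) · Tr[ρ · (log ρ − log(σ #_γ ρ))]`. -/
noncomputable def geomUm {n : ℕ} (ρ σ : Matrix (Fin n) (Fin n) ℂ) (γ : ℝ) : ℝ :=
  (1 / (1 - γ)) * ((ρ * (mfun Real.log ρ - mfun Real.log (geomMean σ ρ γ))).trace).re

section LieTrotter

theorem norm_exp_le_exp_norm {𝔸 : Type*} [NormedRing 𝔸] [NormedAlgebra ℝ 𝔸] [NormOneClass 𝔸]
    (x : 𝔸) : ‖NormedSpace.exp x‖ ≤ Real.exp ‖x‖ := by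
  rw [NormedSpace.exp_eq_tsum ℝ, Real.exp_eq_exp_ℝ, NormedSpace.exp_eq_tsum ℝ]
  refine tsum_of_norm_bounded (NormedSpace.expSeries_summable' (𝕂 := ℝ) ‖x‖).hasSum fun n => ?_
  rw [norm_smul, smul_eq_mul, Real.norm_of_nonneg (by positivity)]
  gcongr
  exact norm_pow_le x n

theorem norm_pow_sub_pow_le {𝔸 : Type*} [NormedRing 𝔸] [NormOneClass 𝔸]
    {x y : 𝔸} {c : ℝ} (hx : ‖x‖ ≤ c) (hy : ‖y‖ ≤ c) (n : ℕ) :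
    ‖x ^ (n + 1) - y ^ (n + 1)‖ ≤ (n + 1) * c ^ n * ‖x - y‖ := by
  have hc : 0 ≤ c := (norm_nonneg x).trans hx
  induction n with
  | zero => simp
  | succ n ih =>
    have h : x ^ (n + 1 + 1) - y ^ (n + 1 + 1)
        = x ^ (n + 1) * (x - y) + (x ^ (n + 1) - y ^ (n + 1)) * y := by
      rw [pow_succ x (n + 1), pow_succ y (n + 1)]; noncomm_ring
    rw [h]
    calc _ ≤ ‖x ^ (n + 1)‖ * ‖x - y‖ + ‖x ^ (n + 1) - y ^ (n + 1)‖ * ‖y‖ :=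
          (norm_add_le _ _).trans (add_le_add (norm_mul_le _ _) (norm_mul_le _ _))
      _ ≤ c ^ (n + 1) * ‖x - y‖ + ((n + 1) * c ^ n * ‖x - y‖) * c := by
          gcongr
          exact (norm_pow_le x _).trans (by gcongr)
      _ = _ := by push_cast; ring

/-- The **Lie–Trotter product formula**. -/
theorem tendsto_exp_mul_exp_pow {𝔸 : Type*} [NormedRing 𝔸] [NormedAlgebra ℝ 𝔸]
    [CompleteSpace 𝔸] [NormOneClass 𝔸] (a b : 𝔸) :
    Filter.Tendsto (fun n : ℕ =>
      (NormedSpace.exp (((n : ℝ) + 1)⁻¹ • a) * NormedSpace.exp (((n : ℝ) + 1)⁻¹ • b)) ^ (n + 1))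
      Filter.atTop (nhds (NormedSpace.exp (a + b))) := by
  let _ : NormedAlgebra ℚ 𝔸 := NormedAlgebra.restrictScalars ℚ ℝ 𝔸
  set φ : ℝ → 𝔸 := fun t =>
    NormedSpace.exp (t • a) * NormedSpace.exp (t • b) - NormedSpace.exp (t • (a + b)) with hφ
  have hd : HasDerivAt φ 0 0 := by
    have h := ((hasDerivAt_exp_smul_const (𝕂 := ℝ) a 0).mul
      (hasDerivAt_exp_smul_const (𝕂 := ℝ) b 0)).sub (hasDerivAt_exp_smul_const (𝕂 := ℝ) (a + b) 0)
    exact h.congr_deriv (by simp)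
  have hlim : Filter.Tendsto (fun n : ℕ => ((n : ℝ) + 1) * ‖φ (((n : ℝ) + 1)⁻¹)‖)
      Filter.atTop (nhds 0) := by
    have h1 := hasDerivAt_iff_tendsto_slope_zero.1 hd
    have h2 : Filter.Tendsto (fun n : ℕ => ((n : ℝ) + 1)⁻¹) Filter.atTop (nhdsWithin 0 {0}ᶜ) := by
      refine tendsto_nhdsWithin_iff.2 ⟨?_, Filter.Eventually.of_forall fun n => ?_⟩
      · simpa [one_div] using tendsto_one_div_add_atTop_nhds_zero_nat (𝕜 := ℝ)
      · simp; positivity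
    have h3 := (h1.comp h2).norm
    rw [norm_zero] at h3
    refine h3.congr fun n => ?_
    have h0 : φ 0 = 0 := by simp [hφ]
    simp only [Function.comp_apply, inv_inv, zero_add, h0, sub_zero, norm_smul]
    rw [Real.norm_of_nonneg (by positivity)]
  rw [tendsto_iff_norm_sub_tendsto_zero]
  refine squeeze_zero (fun _ => norm_nonneg _) (fun n => ?_)
    (by simpa using hlim.const_mul (Real.exp (‖a‖ + ‖b‖)))
  have hn : (0 : ℝ) < (n : ℝ) + 1 := by positivity
  have hsm : ∀ x : 𝔸, ‖((n : ℝ) + 1)⁻¹ • x‖ = ((n : ℝ) + 1)⁻¹ * ‖x‖ := fun x => by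
    rw [norm_smul, Real.norm_of_nonneg (by positivity)]
  have hpow : NormedSpace.exp (a + b) = NormedSpace.exp (((n : ℝ) + 1)⁻¹ • (a + b)) ^ (n + 1) := by
    rw [← NormedSpace.exp_nsmul, ← Nat.cast_smul_eq_nsmul ℝ, smul_smul]
    push_cast
    rw [mul_inv_cancel₀ hn.ne', one_smul]
  set c : ℝ := Real.exp (((n : ℝ) + 1)⁻¹ * (‖a‖ + ‖b‖)) with hc
  have hx : ‖NormedSpace.exp (((n : ℝ) + 1)⁻¹ • a) * NormedSpace.exp (((n : ℝ) + 1)⁻¹ • b)‖ ≤ c := by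
    refine (norm_mul_le _ _).trans ?_
    rw [hc, mul_add, Real.exp_add]
    gcongr
    · exact (norm_exp_le_exp_norm _).trans_eq (by rw [hsm])
    · exact (norm_exp_le_exp_norm _).trans_eq (by rw [hsm])
  have hy : ‖NormedSpace.exp (((n : ℝ) + 1)⁻¹ • (a + b))‖ ≤ c := by
    refine (norm_exp_le_exp_norm _).trans (Real.exp_le_exp.2 ?_)
    rw [hsm]
    gcongr
    exact norm_add_le _ _
  rw [hpow]
  refine (norm_pow_sub_pow_le hx hy n).trans ?_
  have hcn : c ^ n ≤ Real.exp (‖a‖ + ‖b‖) := by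
    rw [hc, ← Real.exp_nat_mul, Real.exp_le_exp, ← mul_assoc]
    refine mul_le_of_le_one_left (by positivity) ?_
    rw [← div_eq_mul_inv, div_le_one hn]
    linarith
  calc _ = c ^ n * (((n : ℝ) + 1) * ‖φ (((n : ℝ) + 1)⁻¹)‖) := by simp only [hφ]; ring
    _ ≤ _ := by gcongr

end LieTrotter

section GoldenThompson

theorem norm_trace_mul_le {ι : Type*} [Fintype ι] (U V : Matrix ι ι ℂ) :
    ‖(U * V).trace‖ ≤ √(U * Uᴴ).trace.re * √(V * Vᴴ).trace.re := by
  have hsq : ∀ W : Matrix ι ι ℂ, (W * Wᴴ).trace.re = ∑ p : ι × ι, ‖W p.1 p.2‖ ^ 2 := fun W => by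
    rw [Fintype.sum_prod_type]
    simp [Matrix.trace, Matrix.mul_apply, Complex.mul_conj, Complex.normSq_eq_norm_sq,
      -Complex.ofReal_pow]
  have hV : (V * Vᴴ).trace.re = ∑ p : ι × ι, ‖V p.2 p.1‖ ^ 2 := by
    rw [hsq, ← (Equiv.prodComm ι ι).sum_comp]; rfl
  rw [hsq, hV]
  refine le_trans ?_ (Real.sum_mul_le_sqrt_mul_sqrt _ _ _)
  rw [Fintype.sum_prod_type]
  simp only [Matrix.trace, Matrix.diag_apply, Matrix.mul_apply, ← norm_mul]
  exact (norm_sum_le _ _).trans (Finset.sum_le_sum fun i _ => norm_sum_le _ _)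

variable {ι : Type*} [Fintype ι] [DecidableEq ι]

theorem trace_mul_pow_comm (U V : Matrix ι ι ℂ) (n : ℕ) :
    ((U * V) ^ n).trace = ((V * U) ^ n).trace := by
  cases n with
  | zero => simp
  | succ n =>
    rw [pow_succ, ← mul_assoc, mul_pow_mul, Matrix.trace_mul_comm, ← mul_assoc, pow_succ']

theorem norm_trace_mul_pow_le (k : ℕ) (U V : Matrix ι ι ℂ) :
    ‖((U * V) ^ 2 ^ k).trace‖ ≤
      √((U * Uᴴ) ^ 2 ^ k).trace.re * √((V * Vᴴ) ^ 2 ^ k).trace.re := by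
  induction k generalizing U V with
  | zero => simpa using norm_trace_mul_le U V
  | succ k ih =>
    have hnn : ∀ W : Matrix ι ι ℂ, 0 ≤ ((W * Wᴴ) ^ 2 ^ k).trace.re := fun W =>
      (Complex.nonneg_iff.1 ((Matrix.posSemidef_self_mul_conjTranspose W).pow _).trace_nonneg).1
    have h1 : ‖((U * V) ^ 2 ^ (k + 1)).trace‖ ≤ ((U * V * (U * V)ᴴ) ^ 2 ^ k).trace.re := by
      have := ih (U * V) (U * V)
      rwa [Real.mul_self_sqrt (hnn _), ← pow_two, ← pow_mul, ← pow_succ'] at this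
    have h2 : ((U * V * (U * V)ᴴ) ^ 2 ^ k).trace = ((Uᴴ * U * (V * Vᴴ)) ^ 2 ^ k).trace := by
      rw [Matrix.conjTranspose_mul, ← mul_assoc, trace_mul_pow_comm]
      simp only [mul_assoc]
    have h3 := ih (Uᴴ * U) (V * Vᴴ)
    simp only [Matrix.conjTranspose_mul, Matrix.conjTranspose_conjTranspose, ← pow_two, ← pow_mul,
      ← pow_succ'] at h3
    rw [trace_mul_pow_comm Uᴴ U] at h3
    refine h1.trans ?_
    rw [h2]
    exact (Complex.re_le_norm _).trans h3

theorem norm_trace_mul_pow_le_of_isHermitian {X Y : Matrix ι ι ℂ} (hX : X.IsHermitian)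
    (hY : Y.IsHermitian) (k : ℕ) :
    ‖((X * Y) ^ 2 ^ k).trace‖ ≤ ‖(X ^ 2 ^ k * Y ^ 2 ^ k).trace‖ := by
  induction k generalizing X Y with
  | zero => simp
  | succ k ih =>
    have hnn : 0 ≤ ((X * Y * (X * Y)ᴴ) ^ 2 ^ k).trace.re :=
      (Complex.nonneg_iff.1 ((Matrix.posSemidef_self_mul_conjTranspose _).pow _).trace_nonneg).1
    have h1 := norm_trace_mul_pow_le k (X * Y) (X * Y)
    rw [Real.mul_self_sqrt hnn, ← pow_two, ← pow_mul, ← pow_succ'] at h1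
    have h2 : ((X * Y * (X * Y)ᴴ) ^ 2 ^ k).trace = ((X ^ 2 * Y ^ 2) ^ 2 ^ k).trace := by
      rw [Matrix.conjTranspose_mul, hX.eq, hY.eq, ← mul_assoc, trace_mul_pow_comm]
      simp only [mul_assoc, pow_two]
    have h3 := ih (hX.pow 2) (hY.pow 2)
    simp only [← pow_mul, ← pow_succ'] at h3
    rw [h2] at h1
    exact (h1.trans (Complex.re_le_norm _)).trans h3

open scoped Matrix.Norms.L2Operator in
/-- The **Golden–Thompson inequality**. -/
theorem trace_exp_add_le {A B : Matrix ι ι ℂ} (hA : A.IsHermitian) (hB : B.IsHermitian) :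
    (NormedSpace.exp (A + B)).trace.re ≤ ‖(NormedSpace.exp A * NormedSpace.exp B).trace‖ := by
  cases isEmpty_or_nonempty ι
  · simp
  have hlim := tendsto_exp_mul_exp_pow A B
  have hsub : Filter.Tendsto (fun k : ℕ => 2 ^ k - 1) Filter.atTop Filter.atTop :=
    (Filter.tendsto_sub_atTop_nat 1).comp (tendsto_pow_atTop_atTop_of_one_lt one_lt_two)
  have htr : Continuous fun M : Matrix ι ι ℂ => M.trace.re :=
    Complex.continuous_re.comp (continuous_id.matrix_trace)
  refine le_of_tendsto ((htr.tendsto _).comp (hlim.comp hsub)) (Filter.Eventually.of_forall fun k => ?_)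
  have hk : 2 ^ k - 1 + 1 = 2 ^ k := Nat.sub_add_cancel Nat.one_le_two_pow
  have hk' : (((2 ^ k - 1 : ℕ) : ℝ) + 1) = ((2 ^ k : ℕ) : ℝ) := by exact_mod_cast congrArg Nat.cast hk
  simp only [Function.comp_apply]
  rw [hk, hk']
  have hp : ∀ M : Matrix ι ι ℂ,
      NormedSpace.exp (((2 ^ k : ℕ) : ℝ)⁻¹ • M) ^ 2 ^ k = NormedSpace.exp M := fun M => by
    rw [← Matrix.exp_nsmul, ← Nat.cast_smul_eq_nsmul ℝ, smul_smul, mul_inv_cancel₀ (by positivity),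
      one_smul]
  have hH : ∀ {M : Matrix ι ι ℂ}, M.IsHermitian →
      (NormedSpace.exp (((2 ^ k : ℕ) : ℝ)⁻¹ • M)).IsHermitian := fun hM =>
    (Matrix.IsHermitian.exp (by
      rw [Matrix.IsHermitian, Matrix.conjTranspose_smul, hM.eq]; simp))
  have := norm_trace_mul_pow_le_of_isHermitian (hH hA) (hH hB) k
  rw [hp, hp] at this
  exact (Complex.re_le_norm _).trans this

end GoldenThompson

section LogKernel

/-- The first divided difference of the logarithm. -/
noncomputable def logKernel (a b : ℝ) : ℝ :=
  if a = b then a⁻¹ else (Real.log a - Real.log b) / (a - b)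

theorem logKernel_comm (a b : ℝ) : logKernel a b = logKernel b a := by
  unfold logKernel
  split_ifs with h h' h'
  · rw [h]
  · exact absurd h.symm h'
  · exact absurd h'.symm h
  · rw [← neg_sub (Real.log b), ← neg_sub b, neg_div_neg_eq]

theorem logKernel_self (a : ℝ) : logKernel a a = a⁻¹ := if_pos rfl

theorem hasDerivAt_logKernel_add {a b t : ℝ} (ha : 0 < a + t) (hb : 0 < b + t) :
    HasDerivAt (fun t => logKernel (a + t) (b + t)) (-((a + t)⁻¹ * (b + t)⁻¹)) t := by
  have hda : HasDerivAt (fun t => a + t) 1 t := (hasDerivAt_id t).const_add a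
  have hdb : HasDerivAt (fun t => b + t) 1 t := (hasDerivAt_id t).const_add b
  by_cases h : a = b
  · subst h
    simp only [logKernel_self]
    refine (hda.inv ha.ne').congr_deriv ?_
    rw [neg_div, one_div, pow_two, mul_inv]
  · have h' : ∀ t, ¬ a + t = b + t := fun t => by simpa using h
    have hab : a - b ≠ 0 := sub_ne_zero.2 h
    simp only [logKernel, if_neg (h' _), add_sub_add_right_eq_sub]
    refine (((hda.log ha.ne').sub (hdb.log hb.ne')).div_const (a - b)).congr_deriv ?_
    have := ha.ne'
    have := hb.ne'
    field_simp
    ring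

theorem tendsto_log_add_sub_log (a : ℝ) :
    Filter.Tendsto (fun t => Real.log (a + t) - Real.log t) Filter.atTop (nhds 0) := by
  simpa only [add_comm] using Real.tendsto_log_comp_add_sub_log a

theorem tendsto_logKernel_add (a b : ℝ) :
    Filter.Tendsto (fun t => logKernel (a + t) (b + t)) Filter.atTop (nhds 0) := by
  by_cases h : a = b
  · subst h
    simp only [logKernel_self]
    exact tendsto_inv_atTop_zero.comp (Filter.tendsto_atTop_add_const_left _ a Filter.tendsto_id)
  · have h' : ∀ t, ¬ a + t = b + t := fun t => by simpa using h
    simp only [logKernel, if_neg (h' _), add_sub_add_right_eq_sub]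
    have := ((tendsto_log_add_sub_log a).sub (tendsto_log_add_sub_log b)).div_const (a - b)
    simpa using this

theorem nonneg_of_hasDerivAt_nonpos_of_tendsto_zero {f f' : ℝ → ℝ}
    (hf : ∀ t, 0 ≤ t → HasDerivAt f (f' t) t) (hf' : ∀ t, 0 ≤ t → f' t ≤ 0)
    (hlim : Filter.Tendsto f Filter.atTop (nhds 0)) : 0 ≤ f 0 := by
  have hanti : AntitoneOn f (Set.Ici 0) := by
    refine antitoneOn_of_deriv_nonpos (convex_Ici 0)
      (fun t ht => (hf t ht).continuousAt.continuousWithinAt) (fun t ht => ?_) (fun t ht => ?_)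
    all_goals rw [interior_Ici] at ht
    · exact (hf t ht.le).differentiableAt.differentiableWithinAt
    · rw [(hf t ht.le).deriv]
      exact hf' t ht.le
  refine le_of_tendsto' (x := Filter.atTop) (hlim.comp tendsto_natCast_atTop_atTop) fun n : ℕ => ?_
  exact hanti (Set.mem_Ici.2 le_rfl) (Set.mem_Ici.2 n.cast_nonneg) n.cast_nonneg

theorem posSemidef_logKernel {ι : Type*} [Fintype ι] {a : ι → ℝ} (ha : ∀ i, 0 < a i) :
    (Matrix.of fun i j => (logKernel (a i) (a j) : ℂ)).PosSemidef := by
  have hH : (Matrix.of fun i j => (logKernel (a i) (a j) : ℂ)).IsHermitian := by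
    ext i j
    simp [Matrix.conjTranspose_apply, logKernel_comm]
  refine Matrix.PosSemidef.of_dotProduct_mulVec_nonneg hH fun x => ?_
  refine Complex.nonneg_iff.2 ⟨?_, (hH.im_star_dotProduct_mulVec_self x).symm⟩
  have key := nonneg_of_hasDerivAt_nonpos_of_tendsto_zero
    (f := fun t => ∑ i, ∑ j, (star (x i) * x j).re * logKernel (a i + t) (a j + t))
    (f' := fun t => ∑ i, ∑ j, (star (x i) * x j).re * (-((a i + t)⁻¹ * (a j + t)⁻¹)))
    (fun t ht => HasDerivAt.fun_sum fun i _ => HasDerivAt.fun_sum fun j _ =>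
      (hasDerivAt_logKernel_add (add_pos_of_pos_of_nonneg (ha i) ht)
        (add_pos_of_pos_of_nonneg (ha j) ht)).const_mul _)
    (fun t _ => ?_) ?_
  · simp only [add_zero] at key
    convert key using 1
    simp only [dotProduct, Matrix.mulVec, Finset.mul_sum, Complex.re_sum, Matrix.of_apply,
      Pi.star_apply]
    refine Finset.sum_congr rfl fun i _ => Finset.sum_congr rfl fun j _ => ?_
    rw [← Complex.re_mul_ofReal]
    congr 1
    ring
  · have h : ∑ i, ∑ j, (star (x i) * x j).re * (-((a i + t)⁻¹ * (a j + t)⁻¹))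
        = -(Complex.normSq (∑ i, x i * ((a i + t)⁻¹ : ℝ))) := by
      rw [← Complex.ofReal_re (Complex.normSq _), Complex.normSq_eq_conj_mul_self, map_sum,
        Finset.sum_mul_sum, Complex.re_sum, ← Finset.sum_neg_distrib]
      refine Finset.sum_congr rfl fun i _ => ?_
      rw [Complex.re_sum, ← Finset.sum_neg_distrib]
      refine Finset.sum_congr rfl fun j _ => ?_
      rw [mul_neg, map_mul, Complex.conj_ofReal, ← Complex.re_mul_ofReal, Complex.ofReal_mul]
      congr 2
      simp only [Complex.star_def]
      ring
    rw [h]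
    exact neg_nonpos.2 (Complex.normSq_nonneg _)
  · have := tendsto_finsetSum (Finset.univ : Finset ι) fun i _ =>
      tendsto_finsetSum (Finset.univ : Finset ι) fun j _ =>
        (tendsto_logKernel_add (a i) (a j)).const_mul (star (x i) * x j).re
    simpa using this

end LogKernel

section Spectral

variable {ι : Type*} [Fintype ι]

theorem re_diag_conj_nonneg {A : Matrix ι ι ℂ} (hA : A.PosSemidef) (U : Matrix ι ι ℂ) (i : ι) :
    0 ≤ ((Uᴴ * A * U) i i).re :=
  (Complex.nonneg_iff.1 (hA.conjTranspose_mul_mul_same U).diag_nonneg).1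

variable [DecidableEq ι]

/-- The matrix `U * diag(d) * Uᴴ`. -/
noncomputable def specMat (U : Matrix ι ι ℂ) (d : ι → ℝ) : Matrix ι ι ℂ :=
  U * Matrix.diagonal (fun i => (d i : ℂ)) * Uᴴ

theorem exists_unitary_mfun_eq_specMat {A : Matrix ι ι ℂ} (hA : A.IsHermitian) :
    ∃ (U : Matrix ι ι ℂ) (a : ι → ℝ), Uᴴ * U = 1 ∧ U * Uᴴ = 1 ∧ A = specMat U a ∧
      (∀ f : ℝ → ℝ, mfun f A = specMat U fun i => f (a i)) ∧
      (A.PosSemidef → ∀ i, 0 ≤ a i) ∧ (A.PosDef → ∀ i, 0 < a i) := by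
  refine ⟨hA.eigenvectorUnitary, hA.eigenvalues, Unitary.coe_star_mul_self _,
    Unitary.coe_mul_star_self _, ?_, fun f => ?_,
    fun h => h.eigenvalues_nonneg, fun h => h.eigenvalues_pos⟩
  · exact hA.spectral_theorem
  · unfold mfun
    rw [dif_pos hA]
    rfl

variable {U : Matrix ι ι ℂ}

theorem specMat_mul (hU : Uᴴ * U = 1) (c d : ι → ℝ) :
    specMat U c * specMat U d = specMat U fun i => c i * d i := by
  unfold specMat
  calc _ = U * diagonal (fun i => (c i : ℂ)) * (Uᴴ * U) * diagonal (fun i => (d i : ℂ)) * Uᴴ := by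
        simp only [mul_assoc]
    _ = _ := by
        rw [hU, mul_one, mul_assoc U, Matrix.diagonal_mul_diagonal]
        simp

theorem specMat_one (hU : U * Uᴴ = 1) : specMat U (fun _ => 1) = 1 := by
  simp [specMat, hU]

theorem specMat_isHermitian (d : ι → ℝ) : (specMat U d).IsHermitian := by
  unfold specMat
  refine Matrix.isHermitian_mul_mul_conjTranspose U ?_
  exact Matrix.isHermitian_diagonal_iff.2 fun i => Complex.conj_ofReal _

theorem specMat_posSemidef {d : ι → ℝ} (hd : ∀ i, 0 ≤ d i) : (specMat U d).PosSemidef :=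
  (Matrix.PosSemidef.diagonal fun i => by simpa using hd i).mul_mul_conjTranspose_same U

theorem specMat_add (c d : ι → ℝ) : specMat U c + specMat U d = specMat U fun i => c i + d i := by
  simp [specMat, ← Matrix.add_mul, ← Matrix.mul_add, Matrix.diagonal_add]

theorem trace_mul_specMat (M : Matrix ι ι ℂ) (d : ι → ℝ) :
    (M * specMat U d).trace = ∑ i, (Uᴴ * M * U) i i * d i := by
  have h : (M * specMat U d).trace = (Uᴴ * M * U * diagonal fun i => (d i : ℂ)).trace := by
    unfold specMat
    rw [← mul_assoc, Matrix.trace_mul_comm]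
    simp only [mul_assoc]
  rw [h]
  simp [Matrix.trace, Matrix.mul_diagonal]

theorem re_trace_mul_specMat (M : Matrix ι ι ℂ) (d : ι → ℝ) :
    (M * specMat U d).trace.re = ∑ i, ((Uᴴ * M * U) i i).re * d i := by
  simp [trace_mul_specMat]

theorem exp_specMat (hU : U * Uᴴ = 1) (d : ι → ℝ) :
    NormedSpace.exp (specMat U d) = specMat U fun i => Real.exp (d i) := by
  have hinv : U⁻¹ = Uᴴ := Matrix.inv_eq_right_inv hU
  unfold specMat
  rw [← hinv, Matrix.exp_conj _ _ ((Matrix.isUnit_iff_isUnit_det U).2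
    (Matrix.isUnit_det_of_right_inverse hU)), Matrix.exp_diagonal]
  congr 3
  ext i
  rw [Pi.coe_exp, ← Complex.exp_eq_exp_ℂ, Complex.ofReal_exp]

theorem trace_mul_re_nonneg {A B : Matrix ι ι ℂ} (hA : A.PosSemidef) (hB : B.PosSemidef) :
    0 ≤ (A * B).trace.re := by
  obtain ⟨U, b, -, -, h, -, hb, -⟩ := exists_unitary_mfun_eq_specMat hB.1
  rw [h, re_trace_mul_specMat]
  exact Finset.sum_nonneg fun i _ => mul_nonneg (re_diag_conj_nonneg hA U i) (hb hB i)

theorem specMat_congr {V : Matrix ι ι ℂ} (hU : Uᴴ * U = 1) (hU' : U * Uᴴ = 1)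
    (hV : Vᴴ * V = 1) (hV' : V * Vᴴ = 1) {d e : ι → ℝ} (h : specMat U d = specMat V e)
    (f : ℝ → ℝ) : specMat U (fun i => f (d i)) = specMat V (fun i => f (e i)) := by
  have h1 : Vᴴ * U * diagonal (fun i => (d i : ℂ)) = diagonal (fun i => (e i : ℂ)) * (Vᴴ * U) := by
    calc _ = Vᴴ * specMat U d * U := by
          simp only [specMat, mul_assoc, hU, mul_one]
      _ = (Vᴴ * V) * diagonal (fun i => (e i : ℂ)) * (Vᴴ * U) := by
          rw [h]; simp only [specMat, mul_assoc]
      _ = _ := by rw [hV, one_mul]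
  have h2 : Vᴴ * U * diagonal (fun i => (f (d i) : ℂ))
      = diagonal (fun i => (f (e i) : ℂ)) * (Vᴴ * U) := by
    ext i j
    have := congrFun (congrFun h1 i) j
    rw [Matrix.mul_diagonal, Matrix.diagonal_mul] at this ⊢
    by_cases hij : d j = e i
    · rw [hij, mul_comm]
    · have h0 : (Vᴴ * U) i j = 0 := by
        have h3 : (Vᴴ * U) i j * ((d j : ℂ) - e i) = 0 := by rw [mul_sub, this]; ring
        exact (mul_eq_zero.1 h3).resolve_right
          (sub_ne_zero.2 fun h => hij (Complex.ofReal_injective h))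
      rw [h0, zero_mul, mul_zero]
  calc _ = V * (Vᴴ * U * diagonal (fun i => (f (d i) : ℂ))) * Uᴴ := by
        simp only [← mul_assoc, hV', one_mul, specMat]
    _ = V * diagonal (fun i => (f (e i) : ℂ)) * Vᴴ * (U * Uᴴ) := by
        rw [h2]; simp only [mul_assoc]
    _ = _ := by rw [hU', mul_one, specMat]

theorem mfun_specMat (hU : Uᴴ * U = 1) (hU' : U * Uᴴ = 1) (f : ℝ → ℝ) (d : ι → ℝ) :
    mfun f (specMat U d) = specMat U fun i => f (d i) := by
  obtain ⟨V, e, hV, hV', h, hf, -, -⟩ := exists_unitary_mfun_eq_specMat (specMat_isHermitian (U := U) d)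
  rw [hf, specMat_congr hU hU' hV hV' h]

theorem mul_specMat_mul (W : Matrix ι ι ℂ) (d : ι → ℝ) :
    W * specMat U d * Wᴴ = specMat (W * U) d := by
  simp only [specMat, Matrix.conjTranspose_mul, mul_assoc]

end Spectral

section Klein

variable {ι : Type*} [Fintype ι] [DecidableEq ι] {U : Matrix ι ι ℂ}

theorem trace_specMat (hU : Uᴴ * U = 1) (d : ι → ℝ) : (specMat U d).trace = ∑ i, (d i : ℂ) := by
  rw [← one_mul (specMat U d), trace_mul_specMat]
  simp [hU]

theorem specMat_eq_sum (U : Matrix ι ι ℂ) (d : ι → ℝ) :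
    specMat U d = ∑ j, (d j : ℂ) • specMat U (Pi.single j 1) := by
  have h : (diagonal fun i => (d i : ℂ))
      = ∑ j, (d j : ℂ) • diagonal fun i => ((Pi.single j 1 : ι → ℝ) i : ℂ) := by
    ext i k
    rw [Matrix.sum_apply]
    by_cases hik : i = k
    · subst hik
      rw [Matrix.diagonal_apply_eq, Finset.sum_eq_single i]
      · simp
      · intro j _ hj
        simp [Pi.single_apply, hj.symm]
      · simp
    · simp [Matrix.diagonal_apply_ne _ hik]
  simp only [specMat]
  rw [h, Finset.mul_sum, Finset.sum_mul]
  simp only [Matrix.mul_smul, Matrix.smul_mul]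

theorem mul_le_mul_log_sub_add_exp {r : ℝ} (hr : 0 < r) (κ : ℝ) :
    r * κ ≤ r * Real.log r - r + Real.exp κ := by
  have h := Real.log_le_sub_one_of_pos (div_pos (Real.exp_pos κ) hr)
  rw [Real.log_div (Real.exp_pos κ).ne' hr.ne', Real.log_exp] at h
  have h2 := mul_le_mul_of_nonneg_left h hr.le
  have h3 : r * (Real.exp κ / r - 1) = Real.exp κ - r := by
    field_simp
  linarith [mul_sub r κ (Real.log r)]

/-- Klein's inequality, twisted by a positive unital trace-preserving map. -/
theorem re_trace_map_mul_le (Φ : Matrix ι ι ℂ →ₗ[ℂ] Matrix ι ι ℂ)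
    (hpos : ∀ A : Matrix ι ι ℂ, A.PosSemidef → (Φ A).PosSemidef) (hone : Φ 1 = 1)
    (htr : ∀ A, (Φ A).trace = A.trace) {ρ K : Matrix ι ι ℂ} (hρ : ρ.PosDef)
    (hK : K.IsHermitian) :
    (Φ ρ * K).trace.re
      ≤ (ρ * mfun Real.log ρ).trace.re - ρ.trace.re + (NormedSpace.exp K).trace.re := by
  obtain ⟨P, r, hP, hP', hρP, hlog, -, hr⟩ := exists_unitary_mfun_eq_specMat hρ.1
  obtain ⟨Q, κ, hQ, hQ', hKQ, -, -, -⟩ := exists_unitary_mfun_eq_specMat hK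
  replace hr := hr hρ
  let E : ι → Matrix ι ι ℂ := fun j => specMat P (Pi.single j 1)
  let D : ι → ι → ℝ := fun k j => ((Qᴴ * Φ (E j) * Q) k k).re
  have hE : ∀ j, (E j).PosSemidef := fun j => specMat_posSemidef fun i => by
    by_cases h : i = j
    · subst h; simp
    · simp [h]
  have hD : ∀ k j, 0 ≤ D k j := fun k j => re_diag_conj_nonneg (hpos _ (hE j)) Q k
  have hcol : ∀ j, ∑ k, D k j = 1 := by
    intro j
    have h1 : (Qᴴ * Φ (E j) * Q).trace = 1 := by
      rw [Matrix.trace_mul_comm, ← mul_assoc, hQ', one_mul, htr, trace_specMat hP]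
      simp [Pi.single_apply, apply_ite]
    rw [← Complex.one_re, ← h1, Matrix.trace, Complex.re_sum]
    rfl
  have hrow : ∀ k, ∑ j, D k j = 1 := by
    intro k
    have h1 : ∑ j, Φ (E j) = 1 := by
      rw [← map_sum, ← hone, ← specMat_one hP', specMat_eq_sum]
      simp [E]
    have h2 : ∑ j, Qᴴ * Φ (E j) * Q = 1 := by
      rw [← Finset.sum_mul, ← Finset.mul_sum, h1, mul_one, hQ]
    have h3 := congrArg Complex.re (congrFun (congrFun h2 k) k)
    rw [Matrix.sum_apply, Complex.re_sum, Matrix.one_apply_eq, Complex.one_re] at h3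
    exact h3
  have hl : (Φ ρ * K).trace.re = ∑ k, ∑ j, D k j * (r j * κ k) := by
    rw [hKQ, re_trace_mul_specMat]
    refine Finset.sum_congr rfl fun k _ => ?_
    have : Qᴴ * Φ ρ * Q = ∑ j, (r j : ℂ) • (Qᴴ * Φ (E j) * Q) := by
      rw [hρP, specMat_eq_sum, map_sum, Finset.mul_sum, Finset.sum_mul]
      simp only [map_smul, Matrix.mul_smul, Matrix.smul_mul]
      rfl
    rw [this, Matrix.sum_apply, Complex.re_sum, Finset.sum_mul]
    refine Finset.sum_congr rfl fun j _ => ?_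
    rw [Matrix.smul_apply, smul_eq_mul, Complex.re_ofReal_mul]
    ring
  have hr1 : (ρ * mfun Real.log ρ).trace.re = ∑ j, r j * Real.log (r j) := by
    rw [hlog]
    nth_rewrite 1 [hρP]
    rw [specMat_mul hP, trace_specMat hP, Complex.re_sum]
    rfl
  have hr2 : ρ.trace.re = ∑ j, r j := by
    nth_rewrite 1 [hρP]
    rw [trace_specMat hP, Complex.re_sum]
    rfl
  have hr3 : (NormedSpace.exp K).trace.re = ∑ k, Real.exp (κ k) := by
    rw [hKQ, exp_specMat hQ', trace_specMat hQ, Complex.re_sum]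
    rfl
  rw [hl, hr1, hr2, hr3]
  calc _ ≤ ∑ k, ∑ j, D k j * (r j * Real.log (r j) - r j + Real.exp (κ k)) :=
        Finset.sum_le_sum fun k _ => Finset.sum_le_sum fun j _ =>
          mul_le_mul_of_nonneg_left (mul_le_mul_log_sub_add_exp (hr j) _) (hD k j)
    _ = ∑ k, ∑ j, D k j * (r j * Real.log (r j) - r j) + ∑ k, ∑ j, D k j * Real.exp (κ k) := by
        simp only [mul_add, Finset.sum_add_distrib]
    _ = _ := by
        rw [Finset.sum_comm]
        simp only [← Finset.sum_mul, hcol, hrow, one_mul, Finset.sum_sub_distrib]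

theorem re_trace_mul_le {ρ K : Matrix ι ι ℂ} (hρ : ρ.PosDef) (hK : K.IsHermitian) :
    (ρ * K).trace.re
      ≤ (ρ * mfun Real.log ρ).trace.re - ρ.trace.re + (NormedSpace.exp K).trace.re :=
  re_trace_map_mul_le LinearMap.id (fun _ h => h) rfl (fun _ => rfl) hρ hK

end Klein

section SchurMap

variable {ι : Type*} [Fintype ι] {U : Matrix ι ι ℂ}

/-- Schur multiplication by the real matrix `k` in the basis given by the columns of `U`. -/
noncomputable def schurMap (U : Matrix ι ι ℂ) (k : ι → ι → ℝ) :
    Matrix ι ι ℂ →ₗ[ℂ] Matrix ι ι ℂ where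
  toFun X := U * (Matrix.of (fun i j => (k i j : ℂ)) ⊙ (Uᴴ * X * U)) * Uᴴ
  map_add' X Y := by
    simp only [Matrix.mul_add, Matrix.add_mul, Matrix.hadamard_add]
  map_smul' c X := by
    simp only [Matrix.mul_smul, Matrix.smul_mul, Matrix.hadamard_smul, RingHom.id_apply]

theorem schurMap_apply (U : Matrix ι ι ℂ) (k : ι → ι → ℝ) (X : Matrix ι ι ℂ) :
    schurMap U k X = U * (Matrix.of (fun i j => (k i j : ℂ)) ⊙ (Uᴴ * X * U)) * Uᴴ := rfl

theorem schurMap_posSemidef {k : ι → ι → ℝ}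
    (hk : (Matrix.of fun i j => (k i j : ℂ)).PosSemidef) {X : Matrix ι ι ℂ} (hX : X.PosSemidef) :
    (schurMap U k X).PosSemidef :=
  (hk.hadamard (hX.conjTranspose_mul_mul_same U)).mul_mul_conjTranspose_same U

theorem re_trace_schurMap_mul (k : ι → ι → ℝ) (X Y : Matrix ι ι ℂ) :
    (schurMap U k X * Y).trace.re
      = ∑ i, ∑ j, k i j * ((Uᴴ * X * U) i j * (Uᴴ * Y * U) j i).re := by
  have h : (schurMap U k X * Y).trace
      = ((Matrix.of (fun i j => (k i j : ℂ)) ⊙ (Uᴴ * X * U)) * (Uᴴ * Y * U)).trace := by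
    rw [schurMap_apply, mul_assoc, mul_assoc, Matrix.trace_mul_comm]
    simp only [mul_assoc]
  rw [h, Matrix.trace, Complex.re_sum]
  refine Finset.sum_congr rfl fun i _ => ?_
  rw [Matrix.diag_apply, Matrix.mul_apply, Complex.re_sum]
  refine Finset.sum_congr rfl fun j _ => ?_
  rw [Matrix.hadamard_apply, Matrix.of_apply, mul_assoc, Complex.re_ofReal_mul]

variable [DecidableEq ι]

theorem conj_schurMap (hU : Uᴴ * U = 1) (l : ι → ι → ℝ) (X : Matrix ι ι ℂ) :
    Uᴴ * schurMap U l X * U = Matrix.of (fun i j => (l i j : ℂ)) ⊙ (Uᴴ * X * U) := by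
  rw [schurMap_apply]
  simp only [mul_assoc, hU, mul_one]
  rw [← mul_assoc Uᴴ U, hU, one_mul]

theorem schurMap_schurMap (hU : Uᴴ * U = 1) (k l : ι → ι → ℝ) (X : Matrix ι ι ℂ) :
    schurMap U k (schurMap U l X) = schurMap U (fun i j => k i j * l i j) X := by
  rw [schurMap_apply, conj_schurMap hU, schurMap_apply]
  congr 2
  ext i j
  simp [mul_assoc]

theorem specMat_mul_mul_specMat (c d : ι → ℝ) (X : Matrix ι ι ℂ) :
    specMat U c * X * specMat U d = schurMap U (fun i j => c i * d j) X := by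
  have h : (Matrix.of (fun i j => ((c i * d j : ℝ) : ℂ)) ⊙ (Uᴴ * X * U))
      = diagonal (fun i => (c i : ℂ)) * (Uᴴ * X * U) * diagonal (fun i => (d i : ℂ)) := by
    ext i j
    rw [Matrix.mul_diagonal, Matrix.diagonal_mul, Matrix.hadamard_apply, Matrix.of_apply,
      Complex.ofReal_mul]
    ring
  rw [schurMap_apply, h]
  simp only [specMat, mul_assoc]

theorem schurMap_one (hU : Uᴴ * U = 1) (hU' : U * Uᴴ = 1) {k : ι → ι → ℝ} (hk : ∀ i, k i i = 1) :
    schurMap U k 1 = 1 := by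
  have h : (Matrix.of (fun i j => (k i j : ℂ)) ⊙ (1 : Matrix ι ι ℂ)) = 1 := by
    ext i j
    by_cases hij : i = j
    · subst hij; simp [hk]
    · simp [Matrix.one_apply_ne hij]
  rw [schurMap_apply, mul_one, hU, h, mul_one, hU']

theorem trace_schurMap (hU : Uᴴ * U = 1) (hU' : U * Uᴴ = 1) {k : ι → ι → ℝ}
    (hk : ∀ i, k i i = 1) (X : Matrix ι ι ℂ) : (schurMap U k X).trace = X.trace := by
  rw [schurMap_apply, Matrix.trace_mul_comm, ← mul_assoc, hU, one_mul]
  calc _ = (Uᴴ * X * U).trace := by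
        simp only [Matrix.trace, Matrix.diag_apply, Matrix.hadamard_apply, Matrix.of_apply, hk,
          Complex.ofReal_one, one_mul]
    _ = _ := by rw [Matrix.trace_mul_comm, ← mul_assoc, hU', one_mul]

end SchurMap

section Tangent

variable {ι : Type*} [Fintype ι] [DecidableEq ι] {U V : Matrix ι ι ℂ}

theorem sum_re_diag_conj (hU : U * Uᴴ = 1) (X : Matrix ι ι ℂ) :
    ∑ i, ((Uᴴ * X * U) i i).re = X.trace.re := by
  have := re_trace_mul_specMat (U := U) X fun _ => 1
  rw [specMat_one hU, mul_one] at this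
  simpa using this.symm

theorem re_trace_mul_inv_sub_nonpos (hU : Uᴴ * U = 1) (hU' : U * Uᴴ = 1) (hV : Vᴴ * V = 1)
    (hV' : V * Vᴴ = 1) {a w : ι → ℝ} (ha : ∀ i, 0 < a i) (hw : ∀ i, 0 < w i)
    {ρ : Matrix ι ι ℂ} (hρ : ρ.PosSemidef) :
    (ρ * specMat U fun i => (a i)⁻¹).trace.re
      - (schurMap U (fun i j => (a i)⁻¹ * (a j)⁻¹) ρ * (specMat V w - specMat U a)).trace.re
      - (ρ * specMat V fun i => (w i)⁻¹).trace.re ≤ 0 := by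
  set A := specMat U fun i => (a i)⁻¹ with hA
  set B := specMat V fun i => (w i)⁻¹ with hB
  have hAA : specMat U a * A = 1 := by
    rw [hA, specMat_mul hU, ← specMat_one hU']
    exact congrArg _ (funext fun i => mul_inv_cancel₀ (ha i).ne')
  have hBB : B * specMat V w = 1 := by
    rw [hB, specMat_mul hV, ← specMat_one hV']
    exact congrArg _ (funext fun i => inv_mul_cancel₀ (hw i).ne')
  have hBB' : specMat V w * B = 1 := by
    rw [hB, specMat_mul hV, ← specMat_one hV']
    exact congrArg _ (funext fun i => mul_inv_cancel₀ (hw i).ne')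
  have hAH : Aᴴ = A := specMat_isHermitian _
  have hwH : (specMat V w)ᴴ = specMat V w := specMat_isHermitian _
  have hpsd : ((1 - A * specMat V w) * B * (1 - A * specMat V w)ᴴ).PosSemidef :=
    (specMat_posSemidef fun i => (inv_pos.2 (hw i)).le).mul_mul_conjTranspose_same _
  have hexp : (1 - A * specMat V w) * B * (1 - A * specMat V w)ᴴ
      = B - A - A + A * specMat V w * A := by
    rw [Matrix.conjTranspose_sub, Matrix.conjTranspose_one, Matrix.conjTranspose_mul, hAH, hwH]
    have h1 : B * (1 - specMat V w * A) = B - A := by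
      rw [mul_sub, mul_one, ← mul_assoc, hBB, one_mul]
    have h2 : A * specMat V w * B = A := by rw [mul_assoc, hBB', mul_one]
    rw [mul_assoc, h1, sub_mul, one_mul, mul_sub, h2]
    abel
  have h3 : (schurMap U (fun i j => (a i)⁻¹ * (a j)⁻¹) ρ * (specMat V w - specMat U a)).trace
      = (ρ * (A * specMat V w * A - A)).trace := by
    rw [← specMat_mul_mul_specMat, ← hA, mul_assoc, mul_assoc, Matrix.trace_mul_comm]
    rw [mul_assoc, mul_assoc, sub_mul, hAA, mul_sub, mul_one, mul_assoc]
  have h4 := trace_mul_re_nonneg hρ hpsd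
  rw [hexp] at h4
  rw [h3]
  simp only [mul_sub, mul_add, Matrix.trace_sub, Matrix.trace_add, Complex.sub_re,
    Complex.add_re] at h4 ⊢
  linarith

/-- The operator concavity of the logarithm, in tangent form. -/
theorem re_trace_mul_log_le (hU : Uᴴ * U = 1) (hU' : U * Uᴴ = 1) (hV : Vᴴ * V = 1)
    (hV' : V * Vᴴ = 1) {a w : ι → ℝ} (ha : ∀ i, 0 < a i) (hw : ∀ i, 0 < w i)
    {ρ : Matrix ι ι ℂ} (hρ : ρ.PosSemidef) :
    (ρ * specMat V fun i => Real.log (w i)).trace.re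
      ≤ (ρ * specMat U fun i => Real.log (a i)).trace.re
        + (schurMap U (fun i j => logKernel (a i) (a j)) ρ
            * (specMat V w - specMat U a)).trace.re := by
  let p : ι → ℝ := fun i => ((Uᴴ * ρ * U) i i).re
  let q : ι → ℝ := fun i => ((Vᴴ * ρ * V) i i).re
  let c : ι → ι → ℝ := fun i j =>
    ((Uᴴ * ρ * U) i j * (Uᴴ * (specMat V w - specMat U a) * U) j i).re
  have hpq : ∑ i, p i = ∑ i, q i := (sum_re_diag_conj hU' ρ).trans (sum_re_diag_conj hV' ρ).symm
  have hposa : ∀ i t, 0 ≤ t → 0 < a i + t := fun i t ht => add_pos_of_pos_of_nonneg (ha i) ht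
  have hposw : ∀ i t, 0 ≤ t → 0 < w i + t := fun i t ht => add_pos_of_pos_of_nonneg (hw i) ht
  have hlog : ∀ b t : ℝ, 0 < b + t → HasDerivAt (fun t => Real.log (b + t)) (b + t)⁻¹ t :=
    fun b t h => (((hasDerivAt_id t).const_add b).log h.ne').congr_deriv (one_div _)
  have key := nonneg_of_hasDerivAt_nonpos_of_tendsto_zero
    (f := fun t => ∑ i, p i * Real.log (a i + t)
      + ∑ i, ∑ j, logKernel (a i + t) (a j + t) * c i j - ∑ i, q i * Real.log (w i + t))
    (f' := fun t => ∑ i, p i * (a i + t)⁻¹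
      + ∑ i, ∑ j, -((a i + t)⁻¹ * (a j + t)⁻¹) * c i j - ∑ i, q i * (w i + t)⁻¹)
    (fun t ht => ((HasDerivAt.fun_sum fun i _ => (hlog _ t (hposa i t ht)).const_mul (p i)).add
      (HasDerivAt.fun_sum fun i _ => HasDerivAt.fun_sum fun j _ =>
        (hasDerivAt_logKernel_add (hposa i t ht) (hposa j t ht)).mul_const (c i j))).sub
      (HasDerivAt.fun_sum fun i _ => (hlog _ t (hposw i t ht)).const_mul (q i)))
    (fun t ht => ?_) ?_
  · simp only [add_zero] at key
    rw [re_trace_mul_specMat, re_trace_mul_specMat, re_trace_schurMap_mul]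
    linarith
  · have h := re_trace_mul_inv_sub_nonpos hU hU' hV hV' (fun i => hposa i t ht)
      (fun i => hposw i t ht) hρ
    have hd : specMat V (fun i => w i + t) - specMat U (fun i => a i + t)
        = specMat V w - specMat U a := by
      have h1 : specMat U (fun _ => t) = specMat V fun _ => t := by
        have : ∀ W : Matrix ι ι ℂ, W * Wᴴ = 1 → specMat W (fun _ => t) = (t : ℂ) • 1 := by
          intro W hW
          rw [← specMat_one hW, specMat, specMat, ← Matrix.smul_mul, ← Matrix.mul_smul]
          congr 2
          ext i j
          by_cases hij : i = j
          · subst hij; simp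
          · simp [hij]
        rw [this U hU', this V hV']
      rw [← specMat_add, ← specMat_add, h1]
      abel
    rw [hd, re_trace_mul_specMat, re_trace_mul_specMat, re_trace_schurMap_mul] at h
    simp only [neg_mul, Finset.sum_neg_distrib]
    linarith
  · have h := ((tendsto_finsetSum (Finset.univ : Finset ι) fun i _ =>
      (tendsto_log_add_sub_log (a i)).const_mul (p i)).add
      (tendsto_finsetSum (Finset.univ : Finset ι) fun i _ =>
        tendsto_finsetSum (Finset.univ : Finset ι) fun j _ =>
        (tendsto_logKernel_add (a i) (a j)).mul_const (c i j))).sub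
      (tendsto_finsetSum (Finset.univ : Finset ι) fun i _ =>
        (tendsto_log_add_sub_log (w i)).const_mul (q i))
    simp only [mul_zero, zero_mul, Finset.sum_const_zero, add_zero, sub_zero] at h
    refine h.congr fun t => ?_
    simp only [mul_sub, Finset.sum_sub_distrib, ← Finset.sum_mul, hpq]
    ring

end Tangent

section Core

variable {ι : Type*} [Fintype ι] [DecidableEq ι] {U V : Matrix ι ι ℂ}

theorem specMat_posDef (hU : Uᴴ * U = 1) (hU' : U * Uᴴ = 1) {d : ι → ℝ} (hd : ∀ i, 0 < d i) :
    (specMat U d).PosDef := by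
  refine (specMat_posSemidef fun i => (hd i).le).posDef_iff_isUnit.2 ?_
  refine (Matrix.isUnit_iff_isUnit_det _).2 (Matrix.isUnit_det_of_right_inverse
    (B := specMat U fun i => (d i)⁻¹) ?_)
  rw [specMat_mul hU, ← specMat_one hU']
  exact congrArg _ (funext fun i => mul_inv_cancel₀ (hd i).ne')

theorem re_trace_schurMap_logKernel_mul_le (hU : Uᴴ * U = 1) (hU' : U * Uᴴ = 1) {a : ι → ℝ}
    (ha : ∀ i, 0 < a i) {ρ L T : Matrix ι ι ℂ} (hρ : ρ.PosDef) (hL : L.IsHermitian)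
    (hT : T = specMat U fun i => √(a i)) (hTL : T * NormedSpace.exp L * T = ρ) :
    (schurMap U (fun i j => logKernel (a i) (a j)) ρ * (T * L * T)).trace.re
      ≤ (ρ * mfun Real.log ρ).trace.re - (ρ * specMat U fun i => Real.log (a i)).trace.re := by
  set m : ι → ι → ℝ := fun i j => √(a i) * √(a j) * logKernel (a i) (a j) with hm
  have hmdiag : ∀ i, m i i = 1 := fun i => by
    rw [hm]
    simp only [logKernel_self]
    rw [Real.mul_self_sqrt (ha i).le, mul_inv_cancel₀ (ha i).ne']
  have hmpsd : (Matrix.of fun i j => (m i j : ℂ)).PosSemidef := by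
    have h := (posSemidef_logKernel ha).mul_mul_conjTranspose_same
      (diagonal fun i => (√(a i) : ℂ))
    convert h using 1
    ext i j
    rw [Matrix.diagonal_conjTranspose, Matrix.mul_diagonal, Matrix.diagonal_mul]
    simp [hm]
    ring
  have h1 : (schurMap U (fun i j => logKernel (a i) (a j)) ρ * (T * L * T)).trace
      = (schurMap U m ρ * L).trace := by
    rw [← schurMap_schurMap hU (fun i j => √(a i) * √(a j)), ← specMat_mul_mul_specMat, ← hT,
      ← mul_assoc, Matrix.trace_mul_comm]
    simp only [mul_assoc]
  have h2 : (schurMap U m ρ * specMat U fun i => Real.log (a i)).trace.re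
      = (ρ * specMat U fun i => Real.log (a i)).trace.re := by
    rw [re_trace_mul_specMat, re_trace_mul_specMat, conj_schurMap hU]
    simp [hmdiag]
  have hK := (specMat_isHermitian (U := U) fun i => Real.log (a i)).add hL
  have h3 := re_trace_map_mul_le (schurMap U m) (fun A hA => schurMap_posSemidef hmpsd hA)
    (schurMap_one hU hU' hmdiag) (trace_schurMap hU hU' hmdiag) hρ hK
  have h4 := trace_exp_add_le (specMat_isHermitian (U := U) fun i => Real.log (a i)) hL
  have h5 : (NormedSpace.exp (specMat U fun i => Real.log (a i)) * NormedSpace.exp L).trace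
      = ρ.trace := by
    have hTT : NormedSpace.exp (specMat U fun i => Real.log (a i)) = T * T := by
      rw [exp_specMat hU', hT, specMat_mul hU]
      congr 1
      funext i
      rw [Real.exp_log (ha i), Real.mul_self_sqrt (ha i).le]
    rw [hTT, ← hTL, mul_assoc, Matrix.trace_mul_comm]
  rw [h5, ← Complex.re_eq_norm.2 hρ.posSemidef.trace_nonneg] at h4
  rw [mul_add, Matrix.trace_add, Complex.add_re, h2] at h3
  rw [h1]
  linarith

theorem mul_specMat_mul_posDef {S : Matrix ι ι ℂ} (hS : S.IsHermitian) (hSu : IsUnit S)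
    (hV : Vᴴ * V = 1) (hV' : V * Vᴴ = 1) {d : ι → ℝ} (hd : ∀ i, 0 < d i) :
    (S * specMat V d * S).PosDef := by
  have h := specMat_posDef hV hV' hd
  have hpsd := h.posSemidef.mul_mul_conjTranspose_same S
  rw [hS.eq] at hpsd
  exact hpsd.posDef_iff_isUnit.2 ((hSu.mul h.isUnit).mul hSu)

theorem exists_tangent_geodesic {S : Matrix ι ι ℂ} (hS : S.IsHermitian) (hSu : IsUnit S)
    (hV : Vᴴ * V = 1) (hV' : V * Vᴴ = 1) {r : ι → ℝ} (hr : ∀ i, 0 < r i)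
    {ρ : Matrix ι ι ℂ} (hρ : ρ.PosDef) (hρr : ρ = S * specMat V r * S) (γ : ℝ) :
    ∃ D : Matrix ι ι ℂ,
      (∀ z : ℝ, (ρ * mfun Real.log (S * specMat V (fun i => r i ^ z) * S)).trace.re
        ≤ (ρ * mfun Real.log (S * specMat V (fun i => r i ^ γ) * S)).trace.re
          + (D * (S * specMat V (fun i => r i ^ z) * S
            - S * specMat V (fun i => r i ^ γ) * S)).trace.re) ∧
      (1 - γ) * (D * (S * specMat V (fun i => r i ^ γ * Real.log (r i)) * S)).trace.re
        ≤ (ρ * mfun Real.log ρ).trace.re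
          - (ρ * mfun Real.log (S * specMat V (fun i => r i ^ γ) * S)).trace.re := by
  have hω : ∀ z : ℝ, (S * specMat V (fun i => r i ^ z) * S).PosDef := fun z =>
    mul_specMat_mul_posDef hS hSu hV hV' fun i => Real.rpow_pos_of_pos (hr i) z
  obtain ⟨U, a, hU, hU', hτ, hτf, -, ha⟩ := exists_unitary_mfun_eq_specMat (hω γ).1
  replace ha := ha (hω γ)
  refine ⟨schurMap U (fun i j => logKernel (a i) (a j)) ρ, fun z => ?_, ?_⟩
  · obtain ⟨W, w, hW, hW', hz, hzf, -, hw⟩ := exists_unitary_mfun_eq_specMat (hω z).1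
    rw [hzf, hτf, hτ, hz]
    exact re_trace_mul_log_le hU hU' hW hW' ha (hw (hω z)) hρ.posSemidef
  · rw [hτf]
    set T := specMat U fun i => √(a i) with hT
    set T' := specMat U fun i => (√(a i))⁻¹ with hT'
    set C := S * specMat V fun i => r i ^ (γ / 2) with hC
    have hTH : Tᴴ = T := specMat_isHermitian _
    have hTH' : T'ᴴ = T' := specMat_isHermitian _
    have hTT' : T * T' = 1 := by
      rw [hT, hT', specMat_mul hU, ← specMat_one hU']
      exact congrArg _ (funext fun i => mul_inv_cancel₀ (Real.sqrt_pos.2 (ha i)).ne')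
    have hT'T : T' * T = 1 := mul_eq_one_comm.1 hTT'
    have hTT : T * T = S * specMat V (fun i => r i ^ γ) * S := by
      rw [hτ, hT, specMat_mul hU]
      exact congrArg _ (funext fun i => Real.mul_self_sqrt (ha i).le)
    have hCC : ∀ d : ι → ℝ, C * specMat V d * Cᴴ
        = S * specMat V (fun i => r i ^ γ * d i) * S := by
      intro d
      have h1 : (specMat V fun i => r i ^ (γ / 2))ᴴ = specMat V fun i => r i ^ (γ / 2) :=
        specMat_isHermitian _
      rw [hC, Matrix.conjTranspose_mul, h1, hS.eq]
      have h2 : specMat V (fun i => r i ^ γ * d i) = (specMat V fun i => r i ^ (γ / 2))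
          * specMat V d * (specMat V fun i => r i ^ (γ / 2)) := by
        rw [specMat_mul hV, specMat_mul hV]
        refine congrArg _ (funext fun i => ?_)
        have : r i ^ γ = r i ^ (γ / 2) * r i ^ (γ / 2) := by
          rw [← Real.rpow_add (hr i), add_halves]
        rw [this]
        ring
      rw [h2]
      simp only [mul_assoc]
    set X := T' * C with hX
    have hTX : T * X = C := by rw [hX, ← mul_assoc, hTT', one_mul]
    have hXX : X * Xᴴ = 1 := by
      have h1 := hCC fun _ => 1
      simp only [mul_one] at h1
      rw [specMat_one hV', mul_one, ← hTT] at h1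
      rw [hX, Matrix.conjTranspose_mul, hTH']
      calc _ = T' * (C * Cᴴ) * T' := by simp only [mul_assoc]
        _ = (T' * T) * (T * T') := by rw [h1]; simp only [mul_assoc]
        _ = 1 := by rw [hT'T, hTT', mul_one]
    have hconj : ∀ d : ι → ℝ, T * specMat (X * V) d * T
        = S * specMat V (fun i => r i ^ γ * d i) * S := by
      intro d
      rw [← hCC, ← hTX, Matrix.conjTranspose_mul, hTH, ← mul_specMat_mul]
      simp only [mul_assoc]
    have hXV : (X * V) * (X * V)ᴴ = 1 := by
      rw [Matrix.conjTranspose_mul, mul_assoc, ← mul_assoc V, hV', one_mul, hXX]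
    have hmain := re_trace_schurMap_logKernel_mul_le hU hU' ha hρ
      (specMat_isHermitian (U := X * V) fun i => (1 - γ) * Real.log (r i)) hT (by
        rw [exp_specMat hXV, hconj, hρr]
        congr 3
        funext i
        rw [mul_comm (1 - γ), ← Real.rpow_def_of_pos (hr i), ← Real.rpow_add (hr i)]
        simp)
    rw [hconj] at hmain
    refine le_trans (le_of_eq ?_) hmain
    rw [← Complex.re_ofReal_mul, ← smul_eq_mul, ← Matrix.trace_smul, ← Matrix.mul_smul]
    congr 3
    have h1 : specMat V (fun i => r i ^ γ * ((1 - γ) * Real.log (r i)))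
        = ((1 - γ : ℝ) : ℂ) • specMat V (fun i => r i ^ γ * Real.log (r i)) := by
      rw [specMat, specMat, ← Matrix.smul_mul, ← Matrix.mul_smul]
      congr 2
      ext i j
      by_cases hij : i = j
      · subst hij
        simp only [Matrix.diagonal_apply_eq, Matrix.smul_apply, smul_eq_mul]
        push_cast
        ring
      · simp [hij]
    rw [h1, Matrix.mul_smul, Matrix.smul_mul]

end Core

section Monotone

theorem div_one_sub_le_div_one_sub {G : ℝ → ℝ} {c : ℝ} (hG : Continuous G)
    (h : ∀ x < 1, ∃ (f : ℝ → ℝ) (f' : ℝ), f x = 0 ∧ HasDerivAt f f' x ∧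
      (∀ z, G z ≤ G x + f z) ∧ (1 - x) * f' ≤ c - G x) {x y : ℝ} (hxy : x ≤ y) (hy : y < 1) :
    (c - G x) / (1 - x) ≤ (c - G y) / (1 - y) := by
  have hcont : ContinuousOn (fun z => -((c - G z) / (1 - z))) (Set.Icc x y) :=
    (((continuous_const.sub hG).continuousOn).div
      ((continuous_const.sub continuous_id).continuousOn)
      fun z hz => (sub_pos.2 (hz.2.trans_lt hy)).ne').neg
  refine neg_le_neg_iff.1 (image_le_of_liminf_slope_right_le_deriv_boundary hcont
    (B := fun _ => -((c - G x) / (1 - x))) (B' := fun _ => 0) le_rfl continuousOn_const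
    (fun z _ => hasDerivWithinAt_const z _ _) ?_ ⟨hxy, le_rfl⟩)
  intro t ht r hr
  have ht1 : t < 1 := ht.2.trans hy
  obtain ⟨f, f', hf0, hf, hle, hf'⟩ := h t ht1
  have hpos := sub_pos.2 ht1
  have hlim : Filter.Tendsto
      (fun z => (slope f t z * (1 - t) - (c - G t)) / ((1 - t) * (1 - z)))
      (nhdsWithin t (Set.Ioi t)) (nhds ((f' * (1 - t) - (c - G t)) / ((1 - t) * (1 - t)))) := by
    have h1 : Filter.Tendsto (slope f t) (nhdsWithin t (Set.Ioi t)) (nhds f') :=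
      (hasDerivAt_iff_tendsto_slope.1 hf).mono_left
        (nhdsWithin_mono t fun z hz => (Set.mem_Ioi.1 hz).ne')
    have h2 : Filter.Tendsto (fun z : ℝ => z) (nhdsWithin t (Set.Ioi t)) (nhds t) :=
      nhdsWithin_le_nhds
    exact ((h1.mul_const _).sub_const _).div ((h2.const_sub 1).const_mul _)
      (mul_pos hpos hpos).ne'
  have hneg : (f' * (1 - t) - (c - G t)) / ((1 - t) * (1 - t)) < r := by
    refine lt_of_le_of_lt (div_nonpos_of_nonpos_of_nonneg ?_ (mul_pos hpos hpos).le) hr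
    linarith [mul_comm f' (1 - t)]
  refine Filter.Eventually.frequently ?_
  filter_upwards [hlim.eventually_lt_const hneg, self_mem_nhdsWithin,
    nhdsWithin_le_nhds (Iio_mem_nhds ht1)] with z hz hzt hz1
  refine lt_of_le_of_lt ?_ hz
  have hzt' : 0 < z - t := sub_pos.2 hzt
  have hz1' : 0 < 1 - z := sub_pos.2 hz1
  have e : slope (fun z => -((c - G z) / (1 - z))) t z
      = ((G z - G t) / (z - t) * (1 - t) - (c - G t)) / ((1 - t) * (1 - z)) := by
    rw [slope_def_field]
    field_simp
    ring
  rw [e, slope_def_field, hf0, sub_zero]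
  have := hle z
  gcongr
  linarith

end Monotone

section Geodesic

variable {ι : Type*} [Fintype ι] [DecidableEq ι] {U V : Matrix ι ι ℂ}

theorem hasDerivAt_re_trace_mul_rpow (M S : Matrix ι ι ℂ) (V : Matrix ι ι ℂ) {r : ι → ℝ}
    (hr : ∀ i, 0 < r i) (γ : ℝ) :
    HasDerivAt (fun z : ℝ => (M * (S * specMat V (fun i => r i ^ z) * S)).trace.re)
      (M * (S * specMat V (fun i => r i ^ γ * Real.log (r i)) * S)).trace.re γ := by
  have h : ∀ d : ι → ℝ, (M * (S * specMat V d * S)).trace.re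
      = ∑ i, ((Vᴴ * (S * M * S) * V) i i).re * d i := by
    intro d
    rw [← re_trace_mul_specMat, ← mul_assoc, Matrix.trace_mul_comm]
    simp only [mul_assoc]
  simp only [h]
  exact HasDerivAt.fun_sum fun i _ =>
    ((Real.hasStrictDerivAt_const_rpow (hr i) γ).hasDerivAt).const_mul _

theorem exp_mfun_log {A : Matrix ι ι ℂ} (hA : A.PosDef) :
    NormedSpace.exp (mfun Real.log A) = A := by
  obtain ⟨U, a, hU, hU', h, hf, -, ha⟩ := exists_unitary_mfun_eq_specMat hA.1
  rw [hf, exp_specMat hU']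
  exact (congrArg _ (funext fun i => Real.exp_log (ha hA i))).trans h.symm

theorem mfun_isHermitian (f : ℝ → ℝ) {A : Matrix ι ι ℂ} (hA : A.IsHermitian) :
    (mfun f A).IsHermitian := by
  obtain ⟨U, a, -, -, -, hf, -, -⟩ := exists_unitary_mfun_eq_specMat hA
  rw [hf]
  exact specMat_isHermitian _

theorem mfun_eq_cfc (f : ℝ → ℝ) (A : Matrix ι ι ℂ) : mfun f A = cfc f A := by
  unfold mfun
  split_ifs with h
  · exact (h.cfc_eq f).symm
  · exact (cfc_apply_of_not_predicate A h).symm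

open scoped Matrix.Norms.L2Operator in
theorem continuous_mfun_log {X : Type*} [TopologicalSpace X] {A : X → Matrix ι ι ℂ}
    (hA : Continuous A) (hpos : ∀ x, (A x).PosDef) :
    Continuous fun x => mfun Real.log (A x) := by
  simp only [mfun_eq_cfc]
  exact CFC.continuousOn_log.comp_continuous hA fun x => ⟨(hpos x).1, (hpos x).isUnit⟩

/-- The lower bound on the Umegaki relative entropy by the difference of traces. -/
theorem re_trace_sub_le_re_trace_mul_log_sub {ρ ω : Matrix ι ι ℂ} (hρ : ρ.PosDef)
    (hω : ω.PosDef) :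
    ρ.trace.re - ω.trace.re
      ≤ (ρ * mfun Real.log ρ).trace.re - (ρ * mfun Real.log ω).trace.re := by
  have h := re_trace_mul_le hρ (mfun_isHermitian Real.log hω.1)
  rw [exp_mfun_log hω] at h
  linarith

/-- The upper bound on the Umegaki relative entropy by the quadratic relative entropy. -/
theorem re_trace_mul_log_sub_le {ρ ω : Matrix ι ι ℂ} (hρ : ρ.PosDef) (hω : ω.PosDef) :
    (ρ * mfun Real.log ρ).trace.re - (ρ * mfun Real.log ω).trace.re
      ≤ (ρ * ρ * ω⁻¹).trace.re - ρ.trace.re := by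
  have hH := (mfun_isHermitian Real.log hρ.1).add (mfun_isHermitian Real.log hρ.1)
  have hN := (mfun_isHermitian Real.log hω.1).neg
  have h := re_trace_mul_le hρ (hH.add hN)
  have hGT := trace_exp_add_le hH hN
  rw [Matrix.exp_neg, exp_mfun_log hω, Matrix.exp_add_of_commute _ _ (Commute.refl _),
    exp_mfun_log hρ] at hGT
  have h0 : 0 ≤ (ρ * ρ * ω⁻¹).trace := by
    have := (hω.inv.posSemidef.mul_mul_conjTranspose_same ρ).trace_nonneg
    rw [hρ.1.eq, mul_assoc, Matrix.trace_mul_comm, mul_assoc, Matrix.trace_mul_comm] at this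
    exact this
  rw [← Complex.re_eq_norm.2 h0] at hGT
  simp only [mul_add, Matrix.mul_neg, Matrix.trace_add, Matrix.trace_neg, Complex.add_re,
    Complex.neg_re] at h
  linarith

end Geodesic

section Interpolation

variable {ι : Type*} [Fintype ι] [DecidableEq ι] {U V : Matrix ι ι ℂ}

theorem mpow_mul_mpow {A : Matrix ι ι ℂ} (hA : A.PosDef) (s t : ℝ) :
    mpow A s * mpow A t = mpow A (s + t) := by
  obtain ⟨U, a, hU, hU', -, h, -, ha⟩ := exists_unitary_mfun_eq_specMat hA.1
  unfold mpow
  rw [h, h, h, specMat_mul hU]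
  exact congrArg _ (funext fun i => (Real.rpow_add (ha hA i) s t).symm)

theorem mpow_zero {A : Matrix ι ι ℂ} (hA : A.PosDef) : mpow A 0 = 1 := by
  obtain ⟨U, a, hU, hU', -, h, -, ha⟩ := exists_unitary_mfun_eq_specMat hA.1
  unfold mpow
  rw [h, ← specMat_one hU']
  exact congrArg _ (funext fun i => Real.rpow_zero _)

theorem mpow_one {A : Matrix ι ι ℂ} (hA : A.PosDef) : mpow A 1 = A := by
  obtain ⟨U, a, hU, hU', h0, h, -, ha⟩ := exists_unitary_mfun_eq_specMat hA.1
  unfold mpow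
  rw [h]
  exact (congrArg _ (funext fun i => Real.rpow_one _)).trans h0.symm

theorem continuous_mul_specMat_rpow_mul (S V : Matrix ι ι ℂ) {r : ι → ℝ} (hr : ∀ i, 0 < r i) :
    Continuous fun z : ℝ => S * specMat V (fun i => r i ^ z) * S := by
  have h : Continuous fun z : ℝ => diagonal fun i => ((r i ^ z : ℝ) : ℂ) :=
    Continuous.matrix_diagonal (continuous_pi fun i => Complex.continuous_ofReal.comp
      (Real.continuous_const_rpow (hr i).ne'))
  unfold specMat
  fun_prop

/-- The conjugation identity behind the Belavkin-Staszewski relative entropy. -/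
theorem re_trace_mul_log_conj {ρ σ : Matrix ι ι ℂ} (hρ : ρ.PosDef) (hσ : σ.PosDef)
    {r : ι → ℝ} (hV : Vᴴ * V = 1) (hV' : V * Vᴴ = 1) (hr : ∀ i, 0 < r i)
    (hρr : mpow σ (-(1 / 2)) * ρ * mpow σ (-(1 / 2)) = specMat V r) :
    (ρ * mfun Real.log (mpow ρ (1 / 2) * mpow σ (-1) * mpow ρ (1 / 2))).trace
      = (mpow σ (1 / 2) * specMat V (fun i => r i * Real.log (r i)) * mpow σ (1 / 2)).trace := by
  set S := mpow σ (1 / 2) with hS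
  set S' := mpow σ (-(1 / 2)) with hS'
  set Q := mpow ρ (1 / 2) with hQ
  have hQQ : Q * Q = ρ := by rw [hQ, mpow_mul_mpow hρ, add_halves, mpow_one hρ]
  have hSS' : S * S' = 1 := by rw [hS, hS', mpow_mul_mpow hσ, add_neg_cancel, mpow_zero hσ]
  have hS'S : S' * S = 1 := mul_eq_one_comm.1 hSS'
  have hσ' : mpow σ (-1) = S' * S' := by rw [hS', mpow_mul_mpow hσ]; norm_num
  have hQH : Qᴴ = Q := mfun_isHermitian _ hρ.1
  have hSH' : S'ᴴ = S' := mfun_isHermitian _ hσ.1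
  set H := specMat V fun i => √(r i) with hH
  set H' := specMat V fun i => (√(r i))⁻¹ with hH'
  have hHH : H * H = specMat V r := by
    rw [hH, specMat_mul hV]
    exact congrArg _ (funext fun i => Real.mul_self_sqrt (hr i).le)
  have hHH' : H * H' = 1 := by
    rw [hH, hH', specMat_mul hV, ← specMat_one hV']
    exact congrArg _ (funext fun i => mul_inv_cancel₀ (Real.sqrt_pos.2 (hr i)).ne')
  have hH'H : H' * H = 1 := mul_eq_one_comm.1 hHH'
  have hHHH : H'ᴴ = H' := specMat_isHermitian _
  have hρ1 : S' * ρ = H * H * S := by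
    rw [hHH, ← hρr, mul_assoc, hS'S, mul_one]
  have hρ2 : ρ * S' = S * (H * H) := by
    rw [hHH, ← hρr, ← mul_assoc, ← mul_assoc, hSS', one_mul]
  set W := H' * S' * Q with hW
  have hWH : Wᴴ = Q * S' * H' := by
    rw [hW, Matrix.conjTranspose_mul, Matrix.conjTranspose_mul, hQH, hSH', hHHH, mul_assoc]
  have hWW : W * Wᴴ = 1 := by
    rw [hWH, hW]
    calc _ = H' * (S' * (Q * Q) * S') * H' := by simp only [mul_assoc]
      _ = (H' * H) * (H * H') := by rw [hQQ, hρr, ← hHH]; simp only [mul_assoc]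
      _ = 1 := by rw [hH'H, hHH', mul_one]
  have hWW' : Wᴴ * W = 1 := mul_eq_one_comm.1 hWW
  have h1 : Q * mpow σ (-1) * Q = specMat (Wᴴ * V) r := by
    rw [← mul_specMat_mul, ← hHH, Matrix.conjTranspose_conjTranspose, hWH, hW, hσ']
    calc _ = Q * S' * (H' * H) * (H * H') * S' * Q := by
          rw [hH'H, hHH']; simp only [mul_assoc, mul_one]
      _ = _ := by simp only [mul_assoc]
  have hu : (Wᴴ * V)ᴴ * (Wᴴ * V) = 1 := by
    rw [Matrix.conjTranspose_mul, Matrix.conjTranspose_conjTranspose]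
    calc _ = Vᴴ * (W * Wᴴ) * V := by simp only [mul_assoc]
      _ = 1 := by rw [hWW, mul_one, hV]
  rw [h1, mfun_specMat hu (mul_eq_one_comm.1 hu), ← mul_specMat_mul,
    Matrix.conjTranspose_conjTranspose]
  have h2 : W * ρ * Wᴴ = H * S * S * H := by
    rw [hWH, hW]
    calc _ = H' * S' * (Q * Q) * (Q * Q) * S' * H' := by
          rw [← hQQ]; simp only [mul_assoc]
      _ = H' * (S' * ρ) * (ρ * S') * H' := by rw [hQQ]; simp only [mul_assoc]
      _ = (H' * H) * H * S * S * H * (H * H') := by rw [hρ1, hρ2]; simp only [mul_assoc]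
      _ = _ := by rw [hH'H, hHH', one_mul, mul_one]
  have h3 : specMat V (fun i => r i * Real.log (r i))
      = H * specMat V (fun i => Real.log (r i)) * H := by
    rw [hH, specMat_mul hV, specMat_mul hV]
    refine congrArg _ (funext fun i => ?_)
    nth_rewrite 1 [← Real.mul_self_sqrt (hr i).le]
    ring
  calc _ = (W * ρ * Wᴴ * specMat V fun i => Real.log (r i)).trace := by
        rw [← mul_assoc, Matrix.trace_mul_comm]
        simp only [mul_assoc]
    _ = (H * (S * (S * (H * specMat V fun i => Real.log (r i))))).trace := by
        rw [h2]; simp only [mul_assoc]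
    _ = _ := by
        rw [h3, Matrix.trace_mul_comm, mul_assoc, Matrix.trace_mul_comm]
        simp only [mul_assoc]

end Interpolation

/-- For positive definite `ρ, σ`, the `γ`-weighted geometric Umegaki relative entropies
`F(γ) := (1/(1-γ)) · Tr[ρ · (log ρ − log(σ #_γ ρ))]`:
(a) are monotone nondecreasing in `γ ∈ (0,1)`;
(b) tend to the Umegaki relative entropy `Tr[ρ · (log ρ − log σ)]` as `γ → 0⁺`;
(c) tend to the Belavkin-Staszewski relative entropy `Tr[ρ · log(ρ^{1/2} σ⁻¹ ρ^{1/2})]`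
as `γ → 1⁻`. -/
theorem geomUm_interpolation {n : ℕ} (ρ σ : Matrix (Fin n) (Fin n) ℂ)
    (hρ : ρ.PosDef) (hσ : σ.PosDef) :
    (∀ γ₁ ∈ Set.Ioo (0 : ℝ) 1, ∀ γ₂ ∈ Set.Ioo (0 : ℝ) 1, γ₁ ≤ γ₂ →
        geomUm ρ σ γ₁ ≤ geomUm ρ σ γ₂)
    ∧ Filter.Tendsto (geomUm ρ σ) (nhdsWithin 0 (Set.Ioo (0 : ℝ) 1))
        (nhds (((ρ * (mfun Real.log ρ - mfun Real.log σ)).trace).re))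
    ∧ Filter.Tendsto (geomUm ρ σ) (nhdsWithin 1 (Set.Ioo (0 : ℝ) 1))
        (nhds (((ρ * mfun Real.log (mpow ρ (1 / 2) * mpow σ (-1) * mpow ρ (1 / 2))).trace).re)) := by
  set S := mpow σ (1 / 2) with hS
  set S' := mpow σ (-(1 / 2)) with hS'
  have hSS : S * S = σ := by rw [hS, mpow_mul_mpow hσ, add_halves, mpow_one hσ]
  have hSS' : S * S' = 1 := by rw [hS, hS', mpow_mul_mpow hσ, add_neg_cancel, mpow_zero hσ]
  have hS'S : S' * S = 1 := mul_eq_one_comm.1 hSS'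
  have hSH : S.IsHermitian := mfun_isHermitian _ hσ.1
  have hSH' : S'ᴴ = S' := mfun_isHermitian _ hσ.1
  have hSu : IsUnit S := IsUnit.of_mul_eq_one S' hSS'
  have hSu' : IsUnit S' := IsUnit.of_mul_eq_one S hS'S
  have hR : (S' * ρ * S').PosDef := by
    have h := hρ.posSemidef.mul_mul_conjTranspose_same S'
    rw [hSH'] at h
    exact h.posDef_iff_isUnit.2 ((hSu'.mul hρ.isUnit).mul hSu')
  obtain ⟨V, r, hV, hV', hRr, hRf, -, hr⟩ := exists_unitary_mfun_eq_specMat hR.1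
  replace hr := hr hR
  have hρr : ρ = S * specMat V r * S := by
    rw [← hRr]
    calc ρ = (S * S') * ρ * (S' * S) := by rw [hSS', hS'S, one_mul, mul_one]
      _ = _ := by simp only [mul_assoc]
  let ω : ℝ → Matrix (Fin n) (Fin n) ℂ := fun z => S * specMat V (fun i => r i ^ z) * S
  have hω : ∀ z, (ω z).PosDef := fun z =>
    mul_specMat_mul_posDef hSH hSu hV hV' fun i => Real.rpow_pos_of_pos (hr i) z
  have hω0 : ω 0 = σ := by
    simp only [ω, Real.rpow_zero]
    rw [specMat_one hV', mul_one, hSS]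
  have hω1 : ω 1 = ρ := by
    simp only [ω, Real.rpow_one]
    exact hρr.symm
  let G : ℝ → ℝ := fun z => (ρ * mfun Real.log (ω z)).trace.re
  let c : ℝ := (ρ * mfun Real.log ρ).trace.re
  have hF : ∀ γ, geomUm ρ σ γ = (c - G γ) / (1 - γ) := by
    intro γ
    have h : geomMean σ ρ γ = ω γ := by
      unfold geomMean
      rw [← hS, ← hS', mpow, hRf]
    rw [geomUm, h, mul_sub, Matrix.trace_sub, Complex.sub_re, one_div_mul_eq_div]
  have hG : Continuous G := by
    have h := continuous_mfun_log (continuous_mul_specMat_rpow_mul S V hr) hω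
    exact Complex.continuous_re.comp (continuous_const.matrix_mul h).matrix_trace
  have hderiv := hasDerivAt_re_trace_mul_rpow (S := S) (V := V) (hr := hr)
  refine ⟨fun γ₁ h₁ γ₂ h₂ h => ?_, ?_, ?_⟩
  · rw [hF, hF]
    refine div_one_sub_le_div_one_sub hG (fun x _ => ?_) h h₂.2
    obtain ⟨D, hD, hD'⟩ := exists_tangent_geodesic hSH hSu hV hV' hr hρ hρr x
    refine ⟨fun z => (D * (ω z - ω x)).trace.re, _, ?_, ?_, hD, hD'⟩
    · simp
    · simp only [mul_sub, Matrix.trace_sub, Complex.sub_re]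
      exact (hderiv D x).sub_const _
  · have h : ContinuousAt (fun γ => (c - G γ) / (1 - γ)) 0 :=
      ((continuous_const.sub hG).continuousAt).div
        ((continuous_const.sub continuous_id).continuousAt) (by simp)
    have h0 : (c - G 0) / (1 - 0) = (ρ * (mfun Real.log ρ - mfun Real.log σ)).trace.re := by
      rw [sub_zero, div_one, mul_sub, Matrix.trace_sub, Complex.sub_re, ← hω0]
    rw [← h0]
    simp only [funext hF]
    exact h.tendsto.mono_left nhdsWithin_le_nhds
  · rw [re_trace_mul_log_conj hρ hσ hV hV' hr hRr, ← hS]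
    set β := (S * specMat V (fun i => r i * Real.log (r i)) * S).trace.re with hβ
    have hd1 : HasDerivAt (fun z => (ω z).trace.re) β 1 := by
      have h := hasDerivAt_re_trace_mul_rpow 1 S V hr 1
      simp only [Real.rpow_one, one_mul] at h
      exact h
    have hinv : ∀ γ, (ω γ)⁻¹ = S' * specMat V (fun i => r i ^ (-γ)) * S' := by
      intro γ
      refine Matrix.inv_eq_right_inv ?_
      have h1 : specMat V (fun i => r i ^ γ) * specMat V (fun i => r i ^ (-γ)) = 1 := by
        rw [specMat_mul hV, ← specMat_one hV']
        refine congrArg _ (funext fun i => ?_)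
        rw [← Real.rpow_add (hr i), add_neg_cancel, Real.rpow_zero]
      calc _ = S * (specMat V (fun i => r i ^ γ) * ((S * S')
            * specMat V (fun i => r i ^ (-γ)))) * S' := by simp only [ω, mul_assoc]
        _ = 1 := by rw [hSS', one_mul, h1, mul_one, hSS']
    have hd2 : HasDerivAt (fun z => (ρ * ρ * (ω z)⁻¹).trace.re) (-β) 1 := by
      have h := (hasDerivAt_re_trace_mul_rpow (ρ * ρ) S' V hr (-1)).comp (1 : ℝ) (hasDerivAt_neg 1)
      simp only [hinv]
      refine h.congr_deriv ?_
      rw [mul_neg_one, hβ]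
      congr 2
      have h1 : specMat V r * specMat V (fun i => r i ^ (-1 : ℝ) * Real.log (r i))
          = specMat V fun i => Real.log (r i) := by
        rw [specMat_mul hV]
        refine congrArg _ (funext fun i => ?_)
        rw [Real.rpow_neg_one, mul_inv_cancel_left₀ (hr i).ne']
      have h2 : specMat V (fun i => Real.log (r i)) * specMat V r
          = specMat V fun i => r i * Real.log (r i) := by
        rw [specMat_mul hV]
        exact congrArg _ (funext fun i => mul_comm _ _)
      have h3 : S' * ρ = specMat V r * S := by
        rw [hρr, mul_assoc, ← mul_assoc, hS'S, one_mul]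
      have h4 : ρ * S' = S * specMat V r := by
        rw [hρr, mul_assoc, hSS', mul_one]
      calc _ = (S' * ρ * (ρ * S')
            * specMat V (fun i => r i ^ (-1 : ℝ) * Real.log (r i))).trace := by
            rw [← mul_assoc, Matrix.trace_mul_comm]
            simp only [mul_assoc]
        _ = (specMat V r * (S * S * specMat V fun i => Real.log (r i))).trace := by
            rw [h3, h4, ← h1]
            simp only [mul_assoc]
        _ = (S * (S * specMat V fun i => r i * Real.log (r i))).trace := by
            rw [Matrix.trace_mul_comm, mul_assoc, h2, mul_assoc]
        _ = _ := Matrix.trace_mul_comm _ _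
    have hfilter : nhdsWithin 1 (Set.Ioo (0 : ℝ) 1) ≤ nhdsWithin 1 {1}ᶜ :=
      nhdsWithin_mono _ fun x hx => hx.2.ne
    have hl := (hasDerivAt_iff_tendsto_slope.1 hd1).mono_left hfilter
    have hu := (hasDerivAt_iff_tendsto_slope.1 hd2).neg.mono_left hfilter
    rw [neg_neg] at hu
    have hρρ : ρ * ρ * ρ⁻¹ = ρ := by
      rw [mul_assoc, Matrix.mul_nonsing_inv _ ((Matrix.isUnit_iff_isUnit_det _).1 hρ.isUnit),
        mul_one]
    refine tendsto_of_tendsto_of_tendsto_of_le_of_le' hl hu ?_ ?_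
    · filter_upwards [self_mem_nhdsWithin] with γ hγ
      rw [hF, slope_def_field, hω1, ← neg_div_neg_eq, neg_sub, neg_sub]
      exact div_le_div_of_nonneg_right (re_trace_sub_le_re_trace_mul_log_sub hρ (hω γ))
        (sub_pos.2 hγ.2).le
    · filter_upwards [self_mem_nhdsWithin] with γ hγ
      rw [hF, slope_def_field, hω1, hρρ, ← div_neg, neg_sub]
      exact div_le_div_of_nonneg_right (re_trace_mul_log_sub_le hρ (hω γ)) (sub_pos.2 hγ.2).le
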